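/- arXiv:2206.09521 — 6 statements merged into one kernel-verified Lean document; each statement's English description precedes it below -/
import Mathlib

section
/- Let G be a finite connected simple graph on vertex set V with at least two vertices, with graph Laplacian L = D - A (where D is the diagonal degree matrix and A is the adjacency matrix). Let W : V → ℝ be a potential and suppose φ : V → ℝ satisfies Lφ + Wφ = Eφ for some E ∈ ℝ, and that the allowed region {v ∈ V : W(v) ≤ E} is nonempty. Then for every vertex v ∈ V one has |φ(v)| ≤ exp(-ρ_E(v)) · ‖φ‖_∞, where ‖φ‖_∞ = max_{u ∈ V} |φ(u)|. -/
open Finset SimpleGraph Matrix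

/-- The Agmon distance `ρ_E(v)` at energy level `E`: the infimum, over all paths (walks)
`v = v₁ → v₂ → ⋯ → v_ℓ` in `G` ending at a vertex `v_ℓ` of the allowed region
(`W(v_ℓ) ≤ E`), of the total cost `Σ_{i=1}^{ℓ} log(1 + (W(vᵢ) - E)₊ / deg(vᵢ))`. -/
noncomputable def agmonDist {V : Type*} [Fintype V] (G : SimpleGraph V) [DecidableRel G.Adj]
    (W : V → ℝ) (E : ℝ) (v : V) : ℝ :=
  sInf { s : ℝ | ∃ (u : V) (p : G.Walk v u), W u ≤ E ∧
    s = (p.support.map fun x =>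
      Real.log (1 + max (W x - E) 0 / (G.degree x : ℝ))).sum }

/-- The Agmon cost of a single vertex is nonnegative. -/
lemma agmonCost_nonneg {V : Type*} [Fintype V] (G : SimpleGraph V) [DecidableRel G.Adj]
    (W : V → ℝ) (E : ℝ) (x : V) :
    0 ≤ Real.log (1 + max (W x - E) 0 / (G.degree x : ℝ)) :=
  Real.log_nonneg (le_add_of_nonneg_right (by positivity))

/-- The Agmon distance is bounded above by the cost of any walk to the allowed region. -/
lemma agmonDist_le {V : Type*} [Fintype V] (G : SimpleGraph V) [DecidableRel G.Adj]
    (W : V → ℝ) (E : ℝ) {v u : V} (p : G.Walk v u) (hu : W u ≤ E) :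
    agmonDist G W E v ≤ (p.support.map fun x =>
      Real.log (1 + max (W x - E) 0 / (G.degree x : ℝ))).sum := by
  refine csInf_le ⟨0, ?_⟩ ⟨u, p, hu, rfl⟩
  rintro s ⟨u, p, -, rfl⟩
  refine List.sum_nonneg fun y hy => ?_
  obtain ⟨x, -, rfl⟩ := List.mem_map.1 hy
  exact agmonCost_nonneg G W E x

/-- At a forbidden vertex of positive degree, a solution of the Schrödinger equation grows by
the factor `1 + (W v - E)₊ / deg v` towards some neighbour. -/
lemma exists_adj_growth {V : Type*} [Fintype V] [DecidableEq V]
    (G : SimpleGraph V) [DecidableRel G.Adj] (W φ : V → ℝ) (E : ℝ) {v : V}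
    (hdeg : 0 < G.degree v) (hv : E < W v)
    (heig : (G.lapMatrix ℝ *ᵥ φ) v + W v * φ v = E * φ v) :
    ∃ w, G.Adj v w ∧ (1 + max (W v - E) 0 / (G.degree v : ℝ)) * |φ v| ≤ |φ w| := by
  by_contra! h
  have hd : (0 : ℝ) < G.degree v := by exact_mod_cast hdeg
  rw [SimpleGraph.lapMatrix_mulVec_apply] at heig
  have hsum : (G.degree v + (W v - E)) * φ v = ∑ w ∈ G.neighborFinset v, φ w := by linarith
  have hlt : ∑ w ∈ G.neighborFinset v, |φ w| <
      ∑ _w ∈ G.neighborFinset v, (1 + max (W v - E) 0 / (G.degree v : ℝ)) * |φ v| := by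
    refine Finset.sum_lt_sum_of_nonempty (Finset.card_pos.1 ?_) fun w hw => h w ?_
    · rwa [G.card_neighborFinset_eq_degree]
    · exact (G.mem_neighborFinset v w).1 hw
  have habs := Finset.abs_sum_le_sum_abs φ (G.neighborFinset v)
  rw [← hsum, abs_mul, abs_of_pos (by linarith : 0 < G.degree v + (W v - E))] at habs
  rw [Finset.sum_const, G.card_neighborFinset_eq_degree, nsmul_eq_mul,
    max_eq_left (by linarith : 0 ≤ W v - E), ← mul_assoc, mul_add, mul_one,
    mul_div_cancel₀ _ hd.ne'] at hlt
  linarith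

/-- From every vertex where `φ` does not vanish there is a walk to the allowed region along
which `|φ|` grows at least by the exponential of the cost. -/
lemma exists_walk_growth {V : Type*} [Fintype V] [DecidableEq V]
    (G : SimpleGraph V) [DecidableRel G.Adj] (W φ : V → ℝ) (E : ℝ)
    (hdeg : ∀ v, 0 < G.degree v)
    (heig : ∀ v, (G.lapMatrix ℝ *ᵥ φ) v + W v * φ v = E * φ v) (v : V) (hv : φ v ≠ 0) :
    ∃ (u : V) (p : G.Walk v u), W u ≤ E ∧
      Real.exp (p.support.map fun x =>
        Real.log (1 + max (W x - E) 0 / (G.degree x : ℝ))).sum * |φ v| ≤ |φ u| := by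
  have hwf : WellFounded fun a b : V => |φ b| < |φ a| :=
    have : IsTrans V fun a b => |φ b| < |φ a| := ⟨fun _ _ _ h₁ h₂ => h₂.trans h₁⟩
    have : Std.Irrefl fun a b : V => |φ b| < |φ a| := ⟨fun _ => lt_irrefl _⟩
    Finite.wellFounded_of_trans_of_irrefl _
  induction v using hwf.induction with
  | _ v ih =>
    rcases le_or_gt (W v) E with hW | hW
    · exact ⟨v, .nil, hW, by simp [max_eq_right (sub_nonpos.2 hW)]⟩
    obtain ⟨w, hvw, hw⟩ := exists_adj_growth G W φ E (hdeg v) hW (heig v)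
    have hd : (0 : ℝ) < G.degree v := by exact_mod_cast hdeg v
    have hφ : 0 < |φ v| := abs_pos.2 hv
    have hc : 0 < max (W v - E) 0 / (G.degree v : ℝ) :=
      div_pos (lt_max_of_lt_left (sub_pos.2 hW)) hd
    have hlt : |φ v| < |φ w| := by nlinarith
    obtain ⟨u, p, hu, hp⟩ := ih w hlt (abs_pos.1 (hφ.trans hlt))
    refine ⟨u, .cons hvw p, hu, ?_⟩
    rw [SimpleGraph.Walk.support_cons, List.map_cons, List.sum_cons, add_comm, Real.exp_add,
      Real.exp_log (by linarith), mul_assoc]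
    exact (mul_le_mul_of_nonneg_left hw (Real.exp_pos _).le).trans hp

/-- **Agmon estimate on graphs.** Let `G` be a finite connected simple graph with at least
two vertices, with Laplacian `L = D - A`. If `φ` satisfies `Lφ + Wφ = Eφ` and the allowed
region `{v : W(v) ≤ E}` is nonempty, then every vertex `v` satisfies
`|φ(v)| ≤ exp(-ρ_E(v)) · ‖φ‖_∞`. -/
theorem agmon_estimate {V : Type*} [Fintype V] [DecidableEq V]
    (G : SimpleGraph V) [DecidableRel G.Adj]
    (hconn : G.Connected) (hcard : 2 ≤ Fintype.card V)
    (W : V → ℝ) (φ : V → ℝ) (E : ℝ)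
    (heig : ∀ v, (G.lapMatrix ℝ *ᵥ φ) v + W v * φ v = E * φ v)
    (hallowed : ∃ v, W v ≤ E) :
    ∀ v, |φ v| ≤ Real.exp (-(agmonDist G W E v)) * (⨆ u, |φ u|) := by
  intro v
  have : Nontrivial V := Fintype.one_lt_card_iff_nontrivial.1 hcard
  have hsup : ∀ u, |φ u| ≤ ⨆ u, |φ u| := le_ciSup (Set.finite_range fun u => |φ u|).bddAbove
  by_cases hv : φ v = 0
  · rw [hv, abs_zero]
    exact mul_nonneg (Real.exp_pos _).le ((abs_nonneg _).trans (hsup v))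
  obtain ⟨u, p, hu, hp⟩ := exists_walk_growth G W φ E
    (fun v => hconn.preconnected.degree_pos_of_nontrivial v) heig v hv
  rw [Real.exp_neg, ← div_eq_inv_mul, le_div_iff₀' (Real.exp_pos _)]
  calc _ ≤ _ := mul_le_mul_of_nonneg_right
          (Real.exp_le_exp.2 (agmonDist_le G W E p hu)) (abs_nonneg _)
    _ ≤ |φ u| := hp
    _ ≤ _ := hsup u
end

section
/- Let G be a finite simple graph on vertex set V with Laplacian L = D - A, let W : V → ℝ, and suppose φ : V → ℝ satisfies Lφ + Wφ = Eφ for some E ∈ ℝ. Then for every vertex u ∈ V with deg(u) ≥ 1 and W(u) > E, one has |φ(u)| ≤ (1 + (W(u) - E)/deg(u))⁻¹ · max_{w : w ~ u} |φ(w)|, where the maximum runs over all neighbors w of u. -/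
open Finset SimpleGraph Matrix

/-- If `φ` solves `Lφ + Wφ = Eφ` and the vertex `u` lies in the forbidden region
(`W(u) > E`) and has degree at least `1`, then
`|φ(u)| ≤ (1 + (W(u) - E)/deg(u))⁻¹ · max_{w ~ u} |φ(w)|`. -/
theorem pointwise_decay_step {V : Type*} [Fintype V] [DecidableEq V]
    (G : SimpleGraph V) [DecidableRel G.Adj]
    (W : V → ℝ) (φ : V → ℝ) (E : ℝ)
    (heig : ∀ v, (G.lapMatrix ℝ *ᵥ φ) v + W v * φ v = E * φ v)
    (u : V) (hdeg : 1 ≤ G.degree u) (hforb : E < W u) :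
    |φ u| ≤ (1 + (W u - E) / (G.degree u : ℝ))⁻¹
      * (G.neighborFinset u).sup' (Finset.card_pos.mp hdeg) (fun w => |φ w|) := by
  set M := (G.neighborFinset u).sup' (Finset.card_pos.mp hdeg) (fun w => |φ w|)
  have hd : (0 : ℝ) < G.degree u := by exact_mod_cast hdeg
  have hsum : ((G.degree u : ℝ) + (W u - E)) * φ u = ∑ w ∈ G.neighborFinset u, φ w := by
    have h := heig u
    rw [lapMatrix_mulVec_apply] at h
    linarith
  have hle : ((G.degree u : ℝ) + (W u - E)) * |φ u| ≤ G.degree u * M := by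
    calc ((G.degree u : ℝ) + (W u - E)) * |φ u|
        = |∑ w ∈ G.neighborFinset u, φ w| := by
          rw [← hsum, abs_mul, abs_of_pos (add_pos hd (sub_pos.mpr hforb))]
      _ ≤ ∑ w ∈ G.neighborFinset u, |φ w| := Finset.abs_sum_le_sum_abs _ _
      _ ≤ #(G.neighborFinset u) • M :=
          Finset.sum_le_card_nsmul _ _ _ fun w hw => Finset.le_sup' (fun w => |φ w|) hw
      _ = G.degree u * M := by rw [card_neighborFinset_eq_degree, nsmul_eq_mul]
  have hpos : 0 < 1 + (W u - E) / (G.degree u : ℝ) :=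
    add_pos one_pos (div_pos (sub_pos.mpr hforb) hd)
  rw [le_inv_mul_iff₀ hpos, one_add_div hd.ne', div_mul_eq_mul_div, div_le_iff₀ hd, mul_comm M]
  exact hle
end

section
/- Let G be a finite simple graph on vertex set V with Laplacian L = D - A, let W : V → ℝ, and suppose φ : V → ℝ satisfies Lφ + Wφ = Eφ for some E ∈ ℝ. If u ∈ V satisfies deg(u) ≥ 1, W(u) > E, and φ(u) ≠ 0, then max_{w : w ~ u} |φ(w)| > |φ(u)|; in particular u has a neighbor w with |φ(w)| > |φ(u)|. -/
open Finset SimpleGraph Matrix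

/-- If `φ` solves `Lφ + Wφ = Eφ`, and `u` is a vertex of degree at least `1` in the
forbidden region (`W(u) > E`) with `φ(u) ≠ 0`, then `max_{w ~ u} |φ(w)| > |φ(u)|`;
in particular `u` has a neighbor `w` with `|φ(w)| > |φ(u)|`. -/
theorem strict_increase_in_forbidden {V : Type*} [Fintype V] [DecidableEq V]
    (G : SimpleGraph V) [DecidableRel G.Adj]
    (W : V → ℝ) (φ : V → ℝ) (E : ℝ)
    (heig : ∀ v, (G.lapMatrix ℝ *ᵥ φ) v + W v * φ v = E * φ v)
    (u : V) (hdeg : 1 ≤ G.degree u) (hforb : E < W u) (hφu : φ u ≠ 0) :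
    |φ u| < (G.neighborFinset u).sup' (Finset.card_pos.mp hdeg) (fun w => |φ w|)
      ∧ ∃ w ∈ G.neighborFinset u, |φ u| < |φ w| := by
  have hex : ∃ w ∈ G.neighborFinset u, |φ u| < |φ w| := by
    by_contra! hle
    have hbound : |∑ w ∈ G.neighborFinset u, φ w| ≤ G.degree u * |φ u| := by
      calc |∑ w ∈ G.neighborFinset u, φ w|
          ≤ ∑ w ∈ G.neighborFinset u, |φ w| := Finset.abs_sum_le_sum_abs _ _
        _ ≤ ∑ _w ∈ G.neighborFinset u, |φ u| := Finset.sum_le_sum hle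
        _ = G.degree u * |φ u| := by
          rw [Finset.sum_const, nsmul_eq_mul, G.card_neighborFinset_eq_degree]
    have hsum : ∑ w ∈ G.neighborFinset u, φ w = (G.degree u + (W u - E)) * φ u := by
      have h := heig u
      rw [G.lapMatrix_mulVec_apply] at h
      linarith
    have hcoef : (0 : ℝ) ≤ G.degree u + (W u - E) := by
      have : (0 : ℝ) ≤ G.degree u := Nat.cast_nonneg _
      linarith
    rw [hsum, abs_mul, abs_of_nonneg hcoef] at hbound
    have hpos : 0 < (W u - E) * |φ u| := mul_pos (sub_pos.mpr hforb) (abs_pos.mpr hφu)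
    linarith
  exact ⟨(Finset.lt_sup'_iff _).mpr hex, hex⟩
end

section
/- Let G be a finite connected simple graph on vertex set V with at least two vertices and Laplacian L = D - A, let W : V → ℝ, and suppose φ : V → ℝ is not identically zero and satisfies Lφ + Wφ = Eφ for some E ∈ ℝ. Then |φ| attains its maximum in the allowed region: there exists a vertex v ∈ V with W(v) ≤ E and |φ(v)| = ‖φ‖_∞ = max_{u ∈ V} |φ(u)|. In particular, max_{u ∈ V} |φ(u)| = max_{u ∈ V, W(u) ≤ E} |φ(u)|. -/
open Finset SimpleGraph Matrix

/-- At a vertex where `|φ|` is maximal, `φ` and `Lφ` do not have opposite signs. -/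
theorem lapMatrix_mulVec_mul_self_nonneg_of_forall_abs_le {V : Type*} [Fintype V] [DecidableEq V]
    (G : SimpleGraph V) [DecidableRel G.Adj] (φ : V → ℝ) (v : V) (hv : ∀ u, |φ u| ≤ |φ v|) :
    0 ≤ (G.lapMatrix ℝ *ᵥ φ) v * φ v := by
  have hle : ∀ u ∈ G.neighborFinset v, φ u * φ v ≤ φ v * φ v := fun u _ =>
    calc φ u * φ v ≤ |φ u| * |φ v| := by rw [← abs_mul]; exact le_abs_self _
      _ ≤ |φ v| * |φ v| := mul_le_mul_of_nonneg_right (hv u) (abs_nonneg _)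
      _ = φ v * φ v := abs_mul_abs_self _
  have hsum := Finset.sum_le_sum hle
  rw [Finset.sum_const, card_neighborFinset_eq_degree, nsmul_eq_mul, ← Finset.sum_mul] at hsum
  rw [lapMatrix_mulVec_apply]
  linarith

/-- If `φ ≢ 0` solves `Lφ + Wφ = Eφ` on a finite connected simple graph with at least two
vertices, then `|φ|` attains its maximum at some vertex of the allowed region `{v : W(v) ≤ E}`;
in particular the maximum of `|φ|` over all vertices equals its maximum over the allowed region. -/
theorem max_attained_in_allowed_region {V : Type*} [Fintype V] [DecidableEq V]
    (G : SimpleGraph V) [DecidableRel G.Adj]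
    (hconn : G.Connected) (hcard : 2 ≤ Fintype.card V)
    (W : V → ℝ) (φ : V → ℝ) (E : ℝ) (hφ : φ ≠ 0)
    (heig : ∀ v, (G.lapMatrix ℝ *ᵥ φ) v + W v * φ v = E * φ v) :
    ∃ v, W v ≤ E ∧ |φ v| = (⨆ u, |φ u|)
      ∧ (⨆ u, |φ u|) = ⨆ u : {u // W u ≤ E}, |φ (u : V)| := by
  have : Nonempty V := hconn.nonempty
  obtain ⟨v, hv⟩ := Finite.exists_max fun u => |φ u|
  have hv0 : φ v ≠ 0 := fun h => hφ <| funext fun u =>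
    abs_nonpos_iff.mp ((hv u).trans_eq (by rw [h, abs_zero]))
  have hW : W v ≤ E := by
    have hnonneg := lapMatrix_mulVec_mul_self_nonneg_of_forall_abs_le G φ v hv
    have hmul : (G.lapMatrix ℝ *ᵥ φ) v * φ v = (E - W v) * (φ v * φ v) := by
      rw [eq_sub_of_add_eq (heig v)]
      ring
    rw [hmul] at hnonneg
    exact sub_nonneg.mp (nonneg_of_mul_nonneg_left hnonneg (mul_self_pos.mpr hv0))
  have hsup : |φ v| = ⨆ u, |φ u| :=
    le_antisymm (le_ciSup (Set.finite_range fun u => |φ u|).bddAbove v) (ciSup_le hv)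
  have : Nonempty {u // W u ≤ E} := ⟨⟨v, hW⟩⟩
  refine ⟨v, hW, hsup, hsup.symm.trans (le_antisymm ?_ (ciSup_le fun u => hv u))⟩
  exact le_ciSup (Set.finite_range fun u : {u // W u ≤ E} => |φ (u : V)|).bddAbove ⟨v, hW⟩
end

section
/- Let G be a finite connected simple graph on vertex set V with at least two vertices and Laplacian L = D - A, let W : V → ℝ, and suppose φ : V → ℝ satisfies Lφ + Wφ = Eφ for some E ∈ ℝ. If u ∈ V satisfies W(u) > E and φ(u) ≠ 0, then there exists a path u = v_1 → v_2 → ⋯ → v_m → v_{m+1} in G consisting of pairwise distinct vertices such that W(v_i) > E for all 1 ≤ i ≤ m, W(v_{m+1}) ≤ E, the values |φ(v_1)| < |φ(v_2)| < ⋯ < |φ(v_{m+1})| are strictly increasing, and |φ(u)| ≤ (Π_{i=1}^{m} (1 + (W(v_i) - E)/deg(v_i))⁻¹) · |φ(v_{m+1})|. -/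
open Finset SimpleGraph Matrix

/-- At a vertex of the forbidden region, some neighbour carries a value larger by the factor
`1 + (W(v) - E)/deg(v)`. -/
lemma exists_adj_mul_abs_le {V : Type*} [Fintype V] [DecidableEq V]
    (G : SimpleGraph V) [DecidableRel G.Adj] {W φ : V → ℝ} {E : ℝ} {v : V}
    (heig : (G.lapMatrix ℝ *ᵥ φ) v + W v * φ v = E * φ v)
    (hdeg : 0 < G.degree v) (hforb : E < W v) :
    ∃ w, G.Adj v w ∧ (1 + (W v - E) / (G.degree v : ℝ)) * |φ v| ≤ |φ w| := by
  have hd : (0 : ℝ) < G.degree v := by exact_mod_cast hdeg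
  rw [lapMatrix_mulVec_apply] at heig
  have hsum : ((G.degree v : ℝ) + (W v - E)) * φ v = ∑ w ∈ G.neighborFinset v, φ w := by
    linarith
  have hle : ((G.degree v : ℝ) + (W v - E)) * |φ v| ≤ ∑ w ∈ G.neighborFinset v, |φ w| := by
    rw [← abs_of_pos (show 0 < (G.degree v : ℝ) + (W v - E) by linarith), ← abs_mul, hsum]
    exact abs_sum_le_sum_abs _ _
  have hne : (G.neighborFinset v).Nonempty := by
    rwa [← card_pos, card_neighborFinset_eq_degree]
  obtain ⟨w, hw, h⟩ := exists_le_of_sum_le (s := G.neighborFinset v)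
    (f := fun _ ↦ (1 + (W v - E) / (G.degree v : ℝ)) * |φ v|) (g := fun w ↦ |φ w|) hne (by
      rwa [sum_const, card_neighborFinset_eq_degree, nsmul_eq_mul, ← mul_assoc, mul_add, mul_one,
        mul_div_cancel₀ _ hd.ne'])
  exact ⟨w, (mem_neighborFinset ..).1 hw, h⟩

/-- If `φ` solves `Lφ + Wφ = Eφ` on a finite connected simple graph with at least two
vertices, and `u` is a vertex of the forbidden region (`W(u) > E`) with `φ(u) ≠ 0`, then
there is a path `u = v₁ → v₂ → ⋯ → v_{m+1}` of pairwise distinct vertices staying in the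
forbidden region until its last vertex `v_{m+1}`, which is allowed, along which `|φ|`
strictly increases, and
`|φ(u)| ≤ (∏_{i=1}^{m} (1 + (W(vᵢ) - E)/deg(vᵢ))⁻¹) · |φ(v_{m+1})|`. -/
theorem escape_path_from_forbidden {V : Type*} [Fintype V] [DecidableEq V]
    (G : SimpleGraph V) [DecidableRel G.Adj]
    (hconn : G.Connected) (hcard : 2 ≤ Fintype.card V)
    (W : V → ℝ) (φ : V → ℝ) (E : ℝ)
    (heig : ∀ v, (G.lapMatrix ℝ *ᵥ φ) v + W v * φ v = E * φ v)
    (u : V) (hforb : E < W u) (hφu : φ u ≠ 0) :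
    ∃ (m : ℕ) (p : Fin (m + 1) → V),
      p 0 = u ∧
      Function.Injective p ∧
      (∀ i : Fin m, G.Adj (p i.castSucc) (p i.succ)) ∧
      (∀ i : Fin m, E < W (p i.castSucc)) ∧
      W (p (Fin.last m)) ≤ E ∧
      (∀ i : Fin m, |φ (p i.castSucc)| < |φ (p i.succ)|) ∧
      |φ u| ≤ (∏ i : Fin m,
          (1 + (W (p i.castSucc) - E) / (G.degree (p i.castSucc) : ℝ))⁻¹)
        * |φ (p (Fin.last m))| := by
  have : Nontrivial V := Fintype.one_lt_card_iff_nontrivial.1 hcard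
  suffices H : ∀ v, φ v ≠ 0 → ∃ (m : ℕ) (p : Fin (m + 1) → V),
      p 0 = v ∧
      (∀ i : Fin m, G.Adj (p i.castSucc) (p i.succ)) ∧
      (∀ i : Fin m, E < W (p i.castSucc)) ∧
      W (p (Fin.last m)) ≤ E ∧
      (∀ i : Fin m, |φ (p i.castSucc)| < |φ (p i.succ)|) ∧
      |φ v| ≤ (∏ i : Fin m,
          (1 + (W (p i.castSucc) - E) / (G.degree (p i.castSucc) : ℝ))⁻¹)
        * |φ (p (Fin.last m))| by
    obtain ⟨m, p, h0, hadj, hW, hlast, hlt, hprod⟩ := H u hφu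
    have hmono : StrictMono fun i ↦ |φ (p i)| := Fin.strictMono_iff_lt_succ.2 hlt
    exact ⟨m, p, h0, Function.Injective.of_comp (f := fun x ↦ |φ x|) hmono.injective,
      hadj, hW, hlast, hlt, hprod⟩
  have hwf : WellFounded fun v w ↦ |φ w| < |φ v| :=
    have : IsTrans V fun v w ↦ |φ w| < |φ v| := ⟨fun _ _ _ h h' ↦ h'.trans h⟩
    have : Std.Irrefl fun v w : V ↦ |φ w| < |φ v| := ⟨fun _ ↦ lt_irrefl _⟩
    Finite.wellFounded_of_trans_of_irrefl _
  intro v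
  induction v using hwf.induction with
  | _ v ih =>
    intro hφv
    rcases le_or_gt (W v) E with hv | hv
    · exact ⟨0, fun _ ↦ v, rfl, by simp, by simp, hv, by simp, by simp⟩
    have hdeg : 0 < G.degree v := hconn.preconnected.degree_pos_of_nontrivial v
    obtain ⟨w, hvw, hle⟩ := exists_adj_mul_abs_le G (heig v) hdeg hv
    have hφv' : 0 < |φ v| := abs_pos.2 hφv
    have hc : 0 < (W v - E) / (G.degree v : ℝ) :=
      div_pos (sub_pos.2 hv) (by exact_mod_cast hdeg)
    have hlt : |φ v| < |φ w| := by nlinarith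
    obtain ⟨m, p, rfl, hadj, hW, hlast, hinc, hprod⟩ := ih w hlt (abs_pos.1 (hφv'.trans hlt))
    refine ⟨m + 1, Fin.cons v p, rfl, Fin.cases hvw hadj, Fin.cases hv hW, hlast,
      Fin.cases hlt hinc, ?_⟩
    rw [Fin.prod_univ_succ, mul_assoc]
    refine (le_inv_mul_iff₀ (by linarith)).2 hle |>.trans ?_
    exact mul_le_mul_of_nonneg_left hprod (inv_nonneg.2 (by linarith))
end

section
/- Let G be a finite connected simple graph on vertex set V with at least two vertices and Laplacian L = D - A, let W : V → ℝ, and suppose φ : V → ℝ satisfies Lφ + Wφ = Eφ for some E ∈ ℝ, with the allowed region {v ∈ V : W(v) ≤ E} nonempty. Let δ > 0 and assume (W(u) - E)/deg(u) ≥ δ for every u in the forbidden region {v : W(v) > E}. Then for every v ∈ V, |φ(v)| ≤ (1 + δ)^{-d(v)} · ‖φ‖_∞, where d(v) denotes the graph distance (minimal number of edges of a path) from v to the allowed region and ‖φ‖_∞ = max_{u ∈ V} |φ(u)|. -/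
open Finset SimpleGraph Matrix

/-- The graph distance from `v` to the allowed region `{u : W(u) ≤ E}`: the minimal number
of edges of a path in `G` from `v` to a vertex of the allowed region (it is `0` for `v` in
the allowed region). -/
noncomputable def distToAllowed {V : Type*} (G : SimpleGraph V)
    (W : V → ℝ) (E : ℝ) (v : V) : ℕ :=
  sInf { n : ℕ | ∃ (u : V) (p : G.Walk v u), W u ≤ E ∧ p.length = n }

theorem distToAllowed_le_length {V : Type*} {G : SimpleGraph V} {W : V → ℝ} {E : ℝ} {v u : V}
    (p : G.Walk v u) (hu : W u ≤ E) : distToAllowed G W E v ≤ p.length :=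
  Nat.sInf_le ⟨u, p, hu, rfl⟩

theorem exists_walk_length_eq_distToAllowed {V : Type*} {G : SimpleGraph V}
    (hconn : G.Connected) {W : V → ℝ} {E : ℝ} (hallowed : ∃ v, W v ≤ E) (v : V) :
    ∃ (u : V) (p : G.Walk v u), W u ≤ E ∧ p.length = distToAllowed G W E v := by
  obtain ⟨a, ha⟩ := hallowed
  obtain ⟨p⟩ := hconn.preconnected v a
  exact Nat.sInf_mem (s := { n : ℕ | ∃ (u : V) (p : G.Walk v u), W u ≤ E ∧ p.length = n })
    ⟨p.length, a, p, ha, rfl⟩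

/-- The distance to the allowed region changes by at most one along an edge. -/
theorem distToAllowed_le_succ_of_adj {V : Type*} {G : SimpleGraph V}
    (hconn : G.Connected) {W : V → ℝ} {E : ℝ} (hallowed : ∃ v, W v ≤ E) {v u : V}
    (h : G.Adj v u) : distToAllowed G W E v ≤ distToAllowed G W E u + 1 := by
  obtain ⟨a, p, ha, hp⟩ := exists_walk_length_eq_distToAllowed hconn hallowed u
  simpa [hp] using distToAllowed_le_length (Walk.cons h p) ha

/-- One step of the Agmon iteration: a bound on the neighbours of a forbidden vertex improves
by the factor `1 + δ` at the vertex itself. -/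
theorem one_add_mul_abs_le_of_forall_adj {V : Type*} [Fintype V] [DecidableEq V]
    (G : SimpleGraph V) [DecidableRel G.Adj] {W φ : V → ℝ} {E δ C : ℝ} {v : V}
    (heig : (G.lapMatrix ℝ *ᵥ φ) v + W v * φ v = E * φ v)
    (hδ : 0 < δ) (hgap : δ ≤ (W v - E) / (G.degree v : ℝ))
    (hC : ∀ u, G.Adj v u → |φ u| ≤ C) : (1 + δ) * |φ v| ≤ C := by
  have hdeg : (0 : ℝ) < G.degree v := by
    rcases (Nat.cast_nonneg (α := ℝ) (G.degree v)).eq_or_lt with h | h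
    · rw [← h, div_zero] at hgap
      linarith
    · exact h
  rw [le_div_iff₀ hdeg] at hgap
  rw [lapMatrix_mulVec_apply] at heig
  have hsum : |∑ u ∈ G.neighborFinset v, φ u| ≤ G.degree v * C := by
    refine (abs_sum_le_sum_abs _ _).trans ?_
    rw [← nsmul_eq_mul, ← G.card_neighborFinset_eq_degree]
    exact sum_le_card_nsmul _ _ _ fun u hu => hC u ((G.mem_neighborFinset v u).1 hu)
  have heq : ∑ u ∈ G.neighborFinset v, φ u = (G.degree v + (W v - E)) * φ v := by
    linarith
  have hpos : 0 ≤ (G.degree v : ℝ) + (W v - E) := by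
    have := mul_pos hδ hdeg
    linarith
  rw [heq, abs_mul, abs_of_nonneg hpos] at hsum
  refine le_of_mul_le_mul_left ?_ hdeg
  calc (G.degree v : ℝ) * ((1 + δ) * |φ v|)
      = (G.degree v + δ * G.degree v) * |φ v| := by ring
    _ ≤ (G.degree v + (W v - E)) * |φ v| := by gcongr
    _ ≤ G.degree v * C := hsum

/-- If `φ` solves `Lφ + Wφ = Eφ` on a finite connected simple graph with nonempty allowed
region, and `(W(u) - E)/deg(u) ≥ δ > 0` on the forbidden region, then
`|φ(v)| ≤ (1 + δ)^{-d(v)} ‖φ‖_∞` where `d(v)` is the graph distance from `v` to the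
allowed region. -/
theorem agmon_estimate_uniform_gap {V : Type*} [Fintype V] [DecidableEq V]
    (G : SimpleGraph V) [DecidableRel G.Adj]
    (hconn : G.Connected) (hcard : 2 ≤ Fintype.card V)
    (W : V → ℝ) (φ : V → ℝ) (E : ℝ)
    (heig : ∀ v, (G.lapMatrix ℝ *ᵥ φ) v + W v * φ v = E * φ v)
    (hallowed : ∃ v, W v ≤ E)
    (δ : ℝ) (hδ : 0 < δ)
    (hgap : ∀ u, E < W u → δ ≤ (W u - E) / (G.degree u : ℝ)) :
    ∀ v, |φ v| ≤ (1 + δ) ^ (-(distToAllowed G W E v : ℤ)) * (⨆ u, |φ u|) := by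
  suffices h : ∀ (n : ℕ) (v : V), n ≤ distToAllowed G W E v →
      |φ v| ≤ ((1 + δ) ^ n)⁻¹ * ⨆ u, |φ u| by
    intro v
    simpa only [_root_.zpow_neg, _root_.zpow_natCast] using h _ v le_rfl
  have hpos : 0 < 1 + δ := by linarith
  intro n
  induction n with
  | zero =>
    intro v _
    simpa using le_ciSup (f := fun u => |φ u|) (Set.finite_range _).bddAbove v
  | succ n ih =>
    intro v hv
    have hforb : E < W v := by
      by_contra! hW
      have := distToAllowed_le_length (Walk.nil : G.Walk v v) hW
      simp only [Walk.length_nil] at this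
      omega
    have hstep := one_add_mul_abs_le_of_forall_adj G (heig v) hδ (hgap v hforb) fun u hu =>
      ih u (by have := distToAllowed_le_succ_of_adj hconn hallowed hu; omega)
    rw [pow_succ', mul_inv, mul_assoc]
    exact (le_inv_mul_iff₀ hpos).2 hstep
end
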